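/- arXiv:1309.5847 — 3 statements merged into one kernel-verified Lean document; each statement's English description precedes it below -/
import Mathlib

section
/- Let k ≥ 1 and j ≥ 1 be integers, and let p̄, q̄ ∈ ℂ[z,z⁻¹] be Laurent polynomials supported in degrees l with k−j+1 ≤ l ≤ j−1 (canonical form of a first-order extension class). Then the transition matrices T_{p̄} = [[z^j, u·p̄],[0, z^{−j}]] and T_{q̄} = [[z^j, u·q̄],[0, z^{−j}]] over R are isomorphic if and only if there exists λ ∈ ℂ∖{0} with q̄ = λ·p̄. -/
open LaurentPolynomial

noncomputable section

/-- The ring `R = ℂ[z,z⁻¹][u]/(u²)`, with `u = inr 1`. -/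
abbrev RZ : Type := TrivSqZeroExt (LaurentPolynomial ℂ) (LaurentPolynomial ℂ)

/-- `p` is a Laurent polynomial supported in degrees `l` with `a ≤ l ≤ b`. -/
def SuppIcc (a b : ℤ) (p : LaurentPolynomial ℂ) : Prop :=
  ∃ c : ℤ → ℂ, p = ∑ l ∈ Finset.Icc a b, c l • T l

/-- `p` lies in `ℂ[z] ⊆ ℂ[z,z⁻¹]`. -/
def InPolyZ (p : LaurentPolynomial ℂ) : Prop := ∃ N : ℤ, SuppIcc 0 N p

/-- `p` lies in `z^m·ℂ[z⁻¹]`, i.e. is supported in degrees `≤ m`. -/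
def SuppLe (m : ℤ) (p : LaurentPolynomial ℂ) : Prop := ∃ N : ℤ, SuppIcc N m p

/-- The subring `O_U = { f(z) + g(z)·u }` of `R`. -/
def OU : Set RZ := { x | InPolyZ x.fst ∧ InPolyZ x.snd }

/-- The subring `O_V = { f(z⁻¹) + g(z⁻¹)·zᵏ·u }` of `R`. -/
def OV (k : ℤ) : Set RZ := { x | SuppLe 0 x.fst ∧ SuppLe k x.snd }

/-- Two 2×2 matrices `T`, `T'` over a ring `A` are isomorphic with respect to
subrings (given as subsets) `SU`, `SV` if `T'·M = N·T` for some matrices `M` (entries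
in `SU`) and `N` (entries in `SV`), each invertible with inverse entries in the
same subring. -/
def MatIso {A : Type*} [Ring A] (SU SV : Set A)
    (T T' : Matrix (Fin 2) (Fin 2) A) : Prop :=
  ∃ M M' N N' : Matrix (Fin 2) (Fin 2) A,
    (∀ a b, M a b ∈ SU) ∧ (∀ a b, M' a b ∈ SU) ∧
    (∀ a b, N a b ∈ SV) ∧ (∀ a b, N' a b ∈ SV) ∧
    M * M' = 1 ∧ M' * M = 1 ∧ N * N' = 1 ∧ N' * N = 1 ∧
    T' * M = N * T

/-- The transition matrix `[[z^{d₁}, u·p],[0, z^{d₂}]]` over `R`. -/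
def Tmat (d₁ d₂ : ℤ) (p : LaurentPolynomial ℂ) : Matrix (Fin 2) (Fin 2) RZ :=
  !![TrivSqZeroExt.inl (T d₁), TrivSqZeroExt.inr p;
     0, TrivSqZeroExt.inl (T d₂)]

theorem SuppIcc.coeff_eq_zero {a b n : ℤ} {p : LaurentPolynomial ℂ} (hp : SuppIcc a b p)
    (hn : n < a ∨ b < n) : p.coeff n = 0 := by
  obtain ⟨c, rfl⟩ := hp
  rw [AddMonoidAlgebra.coeff_sum, Finsupp.finsetSum_apply]
  refine Finset.sum_eq_zero fun l hl => ?_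
  rw [Finset.mem_Icc] at hl
  rw [AddMonoidAlgebra.coeff_smul_apply, T_apply, if_neg (by omega), smul_zero]

theorem InPolyZ.coeff_eq_zero {n : ℤ} {p : LaurentPolynomial ℂ} (hp : InPolyZ p)
    (hn : n < 0) : p.coeff n = 0 := by
  obtain ⟨N, hN⟩ := hp
  exact hN.coeff_eq_zero (Or.inl hn)

theorem SuppLe.coeff_eq_zero {m n : ℤ} {p : LaurentPolynomial ℂ} (hp : SuppLe m p)
    (hn : m < n) : p.coeff n = 0 := by
  obtain ⟨N, hN⟩ := hp
  exact hN.coeff_eq_zero (Or.inr hn)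

theorem coeff_T_mul (m n : ℤ) (f : LaurentPolynomial ℂ) :
    (T m * f).coeff n = f.coeff (n - m) := by
  rw [T, AddMonoidAlgebra.coeff_single_mul_apply, one_mul, neg_add_eq_sub]

theorem suppIcc_zero_zero_C (c : ℂ) : SuppIcc 0 0 (C c) :=
  ⟨fun _ => c, by simp [LaurentPolynomial.smul_eq_C_mul]⟩

theorem suppIcc_zero (a b : ℤ) : SuppIcc a b 0 := ⟨fun _ => 0, by simp⟩

/-- The inclusion of the constants `ℂ` into `R`. -/
def constRZ : ℂ →+* RZ :=
  (TrivSqZeroExt.inlHom (LaurentPolynomial ℂ) (LaurentPolynomial ℂ)).comp C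

theorem constRZ_apply (c : ℂ) : constRZ c = TrivSqZeroExt.inl (C c) := rfl

theorem constRZ_mem_OU (c : ℂ) : constRZ c ∈ OU :=
  ⟨⟨0, suppIcc_zero_zero_C c⟩, ⟨0, suppIcc_zero 0 0⟩⟩

theorem constRZ_mem_OV (k : ℤ) (c : ℂ) : constRZ c ∈ OV k :=
  ⟨⟨0, suppIcc_zero_zero_C c⟩, ⟨0, suppIcc_zero 0 k⟩⟩

theorem matIso_Tmat_smul (k d₁ d₂ : ℤ) (p : LaurentPolynomial ℂ) {c : ℂ} (hc : c ≠ 0) :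
    MatIso OU (OV k) (Tmat d₁ d₂ p) (Tmat d₁ d₂ (c • p)) := by
  have h₁ : (!![c, 0; 0, 1] : Matrix (Fin 2) (Fin 2) ℂ) * !![c⁻¹, 0; 0, 1] = 1 := by
    simp [hc, Matrix.one_fin_two]
  have h₂ : (!![c⁻¹, 0; 0, 1] : Matrix (Fin 2) (Fin 2) ℂ) * !![c, 0; 0, 1] = 1 := by
    simp [hc, Matrix.one_fin_two]
  refine ⟨constRZ.mapMatrix !![c, 0; 0, 1], constRZ.mapMatrix !![c⁻¹, 0; 0, 1],
    constRZ.mapMatrix !![c, 0; 0, 1], constRZ.mapMatrix !![c⁻¹, 0; 0, 1],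
    fun _ _ => constRZ_mem_OU _, fun _ _ => constRZ_mem_OU _,
    fun _ _ => constRZ_mem_OV _ _, fun _ _ => constRZ_mem_OV _ _, ?_, ?_, ?_, ?_, ?_⟩
  · rw [← map_mul, h₁, map_one]
  · rw [← map_mul, h₂, map_one]
  · rw [← map_mul, h₁, map_one]
  · rw [← map_mul, h₂, map_one]
  · ext a b : 1
    fin_cases a <;> fin_cases b <;>
      simp [Tmat, Matrix.mul_apply, Fin.sum_univ_two, mul_comm, constRZ_apply,
        LaurentPolynomial.smul_eq_C_mul, TrivSqZeroExt.ext_iff]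

/-- An element of `ℂ[z]` that also lies in `ℂ[z⁻¹]` is constant. -/
theorem InPolyZ.eq_C_of_suppLe {f : LaurentPolynomial ℂ} (hf : InPolyZ f) (hf' : SuppLe 0 f) :
    f = C (f.coeff 0) := by
  ext n
  rw [C_apply]
  split_ifs with h
  · rw [h]
  · rcases lt_or_gt_of_ne h with h | h
    · exact hf.coeff_eq_zero h
    · exact hf'.coeff_eq_zero h

theorem T_mul_cancel {m : ℤ} {f g : LaurentPolynomial ℂ} (h : T m * f = T m * g) : f = g :=
  (isUnit_T m).mul_left_cancel h

theorem exists_smul_of_matIso {k j : ℤ} (hj : 1 ≤ j) {p q : LaurentPolynomial ℂ}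
    (hp : SuppIcc (k - j + 1) (j - 1) p) (hq : SuppIcc (k - j + 1) (j - 1) q)
    (h : MatIso OU (OV k) (Tmat j (-j) p) (Tmat j (-j) q)) :
    ∃ c : ℂ, c ≠ 0 ∧ q = c • p := by
  obtain ⟨M, M', N, N', hM, -, hN, -, hMM', hM'M, -, -, h⟩ := h
  have h₀₀ := congrArg TrivSqZeroExt.fst (congrFun (congrFun h 0) 0)
  have h₀₁ := congrArg TrivSqZeroExt.fst (congrFun (congrFun h 0) 1)
  have h₀₁' := congrArg TrivSqZeroExt.snd (congrFun (congrFun h 0) 1)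
  have h₁₁ := congrArg TrivSqZeroExt.fst (congrFun (congrFun h 1) 1)
  have e₀₀ := congrArg TrivSqZeroExt.fst (congrFun (congrFun hMM' 0) 0)
  have e₁₁ := congrArg TrivSqZeroExt.fst (congrFun (congrFun hM'M 1) 1)
  simp only [Tmat, Matrix.mul_apply, Fin.sum_univ_two, Matrix.of_apply, Matrix.cons_val',
    Matrix.cons_val_zero, Matrix.cons_val_one, Matrix.cons_val_fin_one,
    TrivSqZeroExt.fst_add, TrivSqZeroExt.snd_add, TrivSqZeroExt.fst_mul, TrivSqZeroExt.snd_mul,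
    TrivSqZeroExt.fst_inl, TrivSqZeroExt.snd_inl, TrivSqZeroExt.fst_inr, TrivSqZeroExt.snd_inr,
    TrivSqZeroExt.fst_one, Matrix.one_apply_eq, smul_eq_mul,
    MulOpposite.smul_eq_mul_unop, MulOpposite.unop_op, zero_mul, mul_zero, add_zero, zero_add, smul_zero]
    at h₀₀ h₀₁ h₀₁' h₁₁ e₀₀ e₁₁
  have hb : (M 0 1).fst = 0 := by
    ext n
    have := congrArg (fun f => f.coeff (n + j)) h₀₁
    simp only [mul_comm _ (T (-j)), coeff_T_mul] at this
    rcases lt_or_ge n 0 with hn | hn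
    · exact (hM 0 1).1.coeff_eq_zero hn
    · rw [(hN 0 1).1.coeff_eq_zero (by omega)] at this
      simpa using this
  have ha : (M 0 0).fst = (N 0 0).fst := T_mul_cancel (h₀₀.trans (mul_comm _ _))
  have ha' := (hM 0 0).1.eq_C_of_suppLe (ha ▸ (hN 0 0).1)
  have hd : (M 1 1).fst = (N 1 1).fst := T_mul_cancel (h₁₁.trans (mul_comm _ _))
  have hd' := (hM 1 1).1.eq_C_of_suppLe (hd ▸ (hN 1 1).1)
  rw [hb, zero_mul, add_zero] at e₀₀
  rw [hb, mul_zero, zero_add] at e₁₁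
  set a := (M 0 0).fst.coeff 0
  set d := (M 1 1).fst.coeff 0
  have ha₀ : a ≠ 0 := by
    intro h0
    rw [ha', h0, map_zero, zero_mul] at e₀₀
    exact zero_ne_one e₀₀
  have hd₀ : d ≠ 0 := by
    intro h0
    rw [hd', h0, map_zero, mul_zero] at e₁₁
    exact zero_ne_one e₁₁
  have key : d • q = a • p := by
    ext n
    by_cases hn : n < k - j + 1 ∨ j - 1 < n
    · rw [AddMonoidAlgebra.coeff_smul_apply, AddMonoidAlgebra.coeff_smul_apply,
        hp.coeff_eq_zero hn, hq.coeff_eq_zero hn, smul_zero, smul_zero]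
    · push Not at hn
      have := congrArg (fun f => f.coeff n) h₀₁'
      rw [← ha, ha', hd'] at this
      simp only [mul_comm _ (T (-j)), AddMonoidAlgebra.coeff_add, Finsupp.add_apply,
        coeff_T_mul, ← LaurentPolynomial.smul_eq_C_mul, mul_comm q] at this
      rw [(hM 0 1).2.coeff_eq_zero (by omega), (hN 0 1).2.coeff_eq_zero (by omega)] at this
      simpa using this
  refine ⟨d⁻¹ * a, mul_ne_zero (inv_ne_zero hd₀) ha₀, ?_⟩
  rw [mul_smul, ← key, inv_smul_smul₀ hd₀]

theorem stmt0 (k j : ℤ) (hk : 1 ≤ k) (hj : 1 ≤ j)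
    (p q : LaurentPolynomial ℂ)
    (hp : SuppIcc (k - j + 1) (j - 1) p) (hq : SuppIcc (k - j + 1) (j - 1) q) :
    MatIso OU (OV k) (Tmat j (-j) p) (Tmat j (-j) q) ↔
      ∃ lam : ℂ, lam ≠ 0 ∧ q = lam • p := by
  refine ⟨exists_smul_of_matIso hj hp hq, ?_⟩
  rintro ⟨c, hc, rfl⟩
  exact matIso_Tmat_smul k j (-j) p hc
end
end

section
/- Let k ≥ 1 and j ≥ 0 be integers with 2j−2 < k. Then for every Laurent polynomial p̄ ∈ ℂ[z,z⁻¹], the matrix T_{p̄} = [[z^j, u·p̄],[0, z^{−j}]] is isomorphic to the diagonal matrix [[z^j, 0],[0, z^{−j}]]. (In other words, when 2j−2 < k every first-order deformation of O(j) ⊕ O(−j) on Z_k is trivial, so 𝔐¹_j(Z_k, 0) is empty.) -/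
open LaurentPolynomial

noncomputable section

theorem SuppIcc.mono {a b a' b' : ℤ} {p : LaurentPolynomial ℂ} (hp : SuppIcc a b p)
    (ha : a' ≤ a) (hb : b ≤ b') : SuppIcc a' b' p := by
  obtain ⟨c, rfl⟩ := hp
  refine ⟨fun l => if l ∈ Finset.Icc a b then c l else 0, ?_⟩
  rw [← Finset.sum_subset (Finset.Icc_subset_Icc ha hb)]
  · exact Finset.sum_congr rfl fun l hl => by simp only [if_pos hl]
  · intro l _ hl
    simp only [if_neg hl, zero_smul]

theorem SuppIcc.add {a b : ℤ} {p q : LaurentPolynomial ℂ} (hp : SuppIcc a b p)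
    (hq : SuppIcc a b q) : SuppIcc a b (p + q) := by
  obtain ⟨c, rfl⟩ := hp
  obtain ⟨d, rfl⟩ := hq
  exact ⟨fun l => c l + d l, by simp only [add_smul, Finset.sum_add_distrib]⟩

theorem SuppIcc.neg {a b : ℤ} {p : LaurentPolynomial ℂ} (hp : SuppIcc a b p) :
    SuppIcc a b (-p) := by
  obtain ⟨c, rfl⟩ := hp
  exact ⟨fun l => -c l, by simp only [neg_smul, Finset.sum_neg_distrib]⟩

theorem suppIcc_smul_T (c : ℂ) (n : ℤ) : SuppIcc n n (c • T n) :=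
  ⟨fun _ => c, by simp⟩

theorem InPolyZ.add {p q : LaurentPolynomial ℂ} (hp : InPolyZ p) (hq : InPolyZ q) :
    InPolyZ (p + q) := by
  obtain ⟨m, hp⟩ := hp
  obtain ⟨n, hq⟩ := hq
  exact ⟨max m n, (hp.mono le_rfl (le_max_left _ _)).add (hq.mono le_rfl (le_max_right _ _))⟩

theorem InPolyZ.neg {p : LaurentPolynomial ℂ} (hp : InPolyZ p) : InPolyZ (-p) :=
  hp.imp fun _ h => h.neg

theorem inPolyZ_zero : InPolyZ 0 := ⟨0, suppIcc_zero _ _⟩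

theorem inPolyZ_smul_T (c : ℂ) {n : ℤ} (hn : 0 ≤ n) : InPolyZ (c • T n) :=
  ⟨n, (suppIcc_smul_T c n).mono hn le_rfl⟩

theorem inPolyZ_one : InPolyZ 1 := by
  simpa using inPolyZ_smul_T 1 le_rfl

theorem SuppLe.add {m : ℤ} {p q : LaurentPolynomial ℂ} (hp : SuppLe m p) (hq : SuppLe m q) :
    SuppLe m (p + q) := by
  obtain ⟨a, hp⟩ := hp
  obtain ⟨b, hq⟩ := hq
  exact ⟨min a b, (hp.mono (min_le_left _ _) le_rfl).add (hq.mono (min_le_right _ _) le_rfl)⟩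

theorem SuppLe.neg {m : ℤ} {p : LaurentPolynomial ℂ} (hp : SuppLe m p) : SuppLe m (-p) :=
  hp.imp fun _ h => h.neg

theorem suppLe_zero (m : ℤ) : SuppLe m 0 := ⟨0, suppIcc_zero _ _⟩

theorem suppLe_smul_T (c : ℂ) {m n : ℤ} (hn : n ≤ m) : SuppLe m (c • T n) :=
  ⟨n, (suppIcc_smul_T c n).mono le_rfl hn⟩

theorem suppLe_one : SuppLe 0 1 := by
  simpa using suppLe_smul_T 1 (le_refl 0)

/-- If `2j - 2 < k`, every Laurent polynomial splits as `zʲ·a - z⁻ʲ·b` with `a ∈ ℂ[z]` and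
`b ∈ zᵏ·ℂ[z⁻¹]`. -/
theorem exists_splitting {k j : ℤ} (h : 2 * j - 2 < k) (p : LaurentPolynomial ℂ) :
    ∃ a b, InPolyZ a ∧ SuppLe k b ∧ T j * a = p + b * T (-j) := by
  induction p using LaurentPolynomial.induction_on' with
  | add p q hp hq =>
    obtain ⟨a, b, ha, hb, hab⟩ := hp
    obtain ⟨a', b', ha', hb', hab'⟩ := hq
    exact ⟨a + a', b + b', ha.add ha', hb.add hb', by linear_combination hab + hab'⟩
  | C_mul_T n c =>
    rw [← smul_eq_C_mul]
    rcases le_or_gt j n with hn | hn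
    · refine ⟨c • T (n - j), 0, inPolyZ_smul_T c (by lia), suppLe_zero k, ?_⟩
      rw [mul_smul_comm, ← T_add, zero_mul, add_zero, add_sub_cancel]
    · refine ⟨0, -(c • T (n + j)), inPolyZ_zero, (suppLe_smul_T c (by lia)).neg, ?_⟩
      rw [neg_mul, smul_mul_assoc, ← T_add, mul_zero, add_neg_cancel_right, add_neg_cancel]

/-- The unipotent matrix `[[1, u·a],[0, 1]]` over `R`. -/
def unipotent (a : LaurentPolynomial ℂ) : Matrix (Fin 2) (Fin 2) RZ :=
  !![1, TrivSqZeroExt.inr a; 0, 1]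

theorem unipotent_mul (a b : LaurentPolynomial ℂ) :
    unipotent a * unipotent b = unipotent (a + b) := by
  simp [unipotent, add_comm, -DualNumber.inr_eq_smul_eps]

theorem unipotent_zero : unipotent 0 = 1 := by
  simp [unipotent, Matrix.one_fin_two]

theorem unipotent_mul_neg (a : LaurentPolynomial ℂ) : unipotent a * unipotent (-a) = 1 := by
  rw [unipotent_mul, add_neg_cancel, unipotent_zero]

theorem unipotent_neg_mul (a : LaurentPolynomial ℂ) : unipotent (-a) * unipotent a = 1 := by
  rw [unipotent_mul, neg_add_cancel, unipotent_zero]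

theorem unipotent_mem_OU {a : LaurentPolynomial ℂ} (ha : InPolyZ a) (i l : Fin 2) :
    unipotent a i l ∈ OU := by
  fin_cases i <;> fin_cases l <;>
    simp [unipotent, OU, ha, inPolyZ_zero, inPolyZ_one]

theorem unipotent_mem_OV {k : ℤ} {b : LaurentPolynomial ℂ} (hb : SuppLe k b) (i l : Fin 2) :
    unipotent b i l ∈ OV k := by
  fin_cases i <;> fin_cases l <;>
    simp [unipotent, OV, hb, suppLe_zero, suppLe_one]

theorem stmt4 (k j : ℤ) (hk : 1 ≤ k) (hj : 0 ≤ j) (h : 2 * j - 2 < k)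
    (p : LaurentPolynomial ℂ) :
    MatIso OU (OV k) (Tmat j (-j) p) (Tmat j (-j) 0) := by
  obtain ⟨a, b, ha, hb, hab⟩ := exists_splitting h p
  refine ⟨unipotent a, unipotent (-a), unipotent b, unipotent (-b), unipotent_mem_OU ha,
    unipotent_mem_OU ha.neg, unipotent_mem_OV hb, unipotent_mem_OV hb.neg, unipotent_mul_neg a,
    unipotent_neg_mul a, unipotent_mul_neg b, unipotent_neg_mul b, ?_⟩
  have hab' : (TrivSqZeroExt.inl (T j) * TrivSqZeroExt.inr a : RZ) =
      TrivSqZeroExt.inr p + TrivSqZeroExt.inr b * TrivSqZeroExt.inl (T (-j)) := by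
    rw [TrivSqZeroExt.inl_mul_inr, TrivSqZeroExt.inr_mul_inl, ← TrivSqZeroExt.inr_add,
      smul_eq_mul, op_smul_eq_mul, hab]
  simp [Tmat, unipotent, hab', -DualNumber.inr_eq_smul_eps]
end
end

section
/- Let j ≥ 1 be an integer, δ ∈ {0,1}, and set n = 4j−5+2δ, assuming n ≥ 1. Then for every integer q with 1 ≤ q ≤ 2n, the q-th homotopy group of ℂℙ^n is isomorphic to that of ℂℙ^{n+4}: π_q(ℂℙ^n) ≅ π_q(ℂℙ^{n+4}). (Via the identifications 𝔐¹_j(W_i, δ) ≅ ℂℙ^{4j−5+2δ} and 𝔐¹_{j+1}(W_i, δ) ≅ ℂℙ^{4j−1+2δ}, this is the Atiyah–Jones type stability π_q(𝔐¹_j(W_i, δ)) ≅ π_q(𝔐¹_{j+1}(W_i, δ)) in the stable range.) -/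
noncomputable section

/-- The complex projective space `ℂℙⁿ`, as the projectivization of `ℂ^{n+1}`. -/
def CP (n : ℕ) : Type := Projectivization ℂ (Fin (n + 1) → ℂ)

/-- `ℂℙⁿ` carries the quotient topology from `ℂ^{n+1} \ {0}`. -/
instance (n : ℕ) : TopologicalSpace (CP n) :=
  inferInstanceAs (TopologicalSpace (Quotient (projectivizationSetoid ℂ (Fin (n + 1) → ℂ))))


open Topology Topology.Homotopy unitInterval

namespace HomotopyGroup

variable {N X Y : Type*} [TopologicalSpace X] [TopologicalSpace Y] {x : X} {y : Y}

/-- The generalized loop `g ∘ p`. -/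
def _root_.GenLoop.map (g : C(X, Y)) (hg : g x = y) (p : Ω^ N X x) : Ω^ N Y y :=
  ⟨g.comp p.1, fun t ht => by
    rw [ContinuousMap.comp_apply, p.2 t ht, hg]⟩

/-- The group homomorphism induced on homotopy groups by a pointed continuous map. -/
def map [DecidableEq N] [Nonempty N] (g : C(X, Y)) (hg : g x = y) :
    HomotopyGroup N X x →* HomotopyGroup N Y y :=
  MonoidHom.mk' (Quotient.map (GenLoop.map g hg) fun _ _ h =>
    ContinuousMap.HomotopicRel.comp_continuousMap h g) <| by
    rintro ⟨p⟩ ⟨q⟩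
    let i : N := Classical.arbitrary N
    have h₁ := mul_spec (i := i) (p := p) (q := q)
    have h₂ := mul_spec (i := i) (p := GenLoop.map g hg p) (q := GenLoop.map g hg q)
    refine (congrArg (Quotient.map (GenLoop.map g hg) fun _ _ h =>
      ContinuousMap.HomotopicRel.comp_continuousMap h g) h₁).trans (Eq.trans ?_ h₂.symm)
    refine congrArg (Quotient.mk _) (GenLoop.ext _ _ fun t => ?_)
    exact apply_ite g _ _ _

/-- A pointed homeomorphism induces an isomorphism of homotopy groups. -/
def congrHomeomorph [DecidableEq N] [Nonempty N] (e : X ≃ₜ Y) (he : e x = y) :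
    HomotopyGroup N X x ≃* HomotopyGroup N Y y where
  __ := map (N := N) (e : C(X, Y)) he
  invFun := map (N := N) (e.symm : C(Y, X)) (e.symm_apply_eq.mpr he.symm)
  left_inv := by
    rintro ⟨p⟩
    exact congrArg (Quotient.mk _) (GenLoop.ext _ _ fun t => e.symm_apply_apply _)
  right_inv := by
    rintro ⟨p⟩
    exact congrArg (Quotient.mk _) (GenLoop.ext _ _ fun t => e.apply_symm_apply _)

end HomotopyGroup

namespace CP

variable {m n : ℕ}

/-- The quotient map `ℂⁿ⁺¹ \ {0} → ℂℙⁿ`. -/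
def mk (u : {u : Fin (n + 1) → ℂ // u ≠ 0}) : CP n :=
  Quotient.mk (projectivizationSetoid ℂ (Fin (n + 1) → ℂ)) u

theorem isOpenQuotientMap_mk : IsOpenQuotientMap (mk (n := n)) where
  surjective := Quotient.mk_surjective
  continuous := continuous_quot_mk
  isOpenMap U hU := by
    have key : mk ⁻¹' (mk '' U) = ⋃ c : ℂˣ,
        {u : {u : Fin (n + 1) → ℂ // u ≠ 0} |
          (⟨c • u.1, (smul_ne_zero_iff_ne c).mpr u.2⟩ : {u : Fin (n + 1) → ℂ // u ≠ 0}) ∈ U} := by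
      ext u
      simp only [Set.mem_preimage, Set.mem_image, Set.mem_iUnion]
      constructor
      · rintro ⟨w, hw, h⟩
        obtain ⟨c, hc⟩ := Quotient.exact h
        refine ⟨c, ?_⟩
        have e : (⟨c • u.1, (smul_ne_zero_iff_ne c).mpr u.2⟩ :
            {u : Fin (n + 1) → ℂ // u ≠ 0}) = w := Subtype.ext hc
        rwa [Set.mem_ofPred_eq, e]
      · rintro ⟨c, hc⟩
        exact ⟨_, hc, Quotient.sound ⟨c, rfl⟩⟩
    change IsOpen (mk ⁻¹' (mk '' U))
    rw [key]
    refine isOpen_iUnion fun c => hU.preimage ?_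
    exact (continuous_subtype_val.const_smul c).subtype_mk _

open Classical in
/-- The point of `ℂℙⁿ` with given homogeneous coordinates, with a junk value at `0`. -/
def ofVec (u : Fin (n + 1) → ℂ) : CP n :=
  if h : u ≠ 0 then mk ⟨u, h⟩ else mk ⟨fun _ => 1, fun h => one_ne_zero (congrFun h 0)⟩

theorem ofVec_of_ne_zero {u : Fin (n + 1) → ℂ} (h : u ≠ 0) : ofVec u = mk ⟨u, h⟩ :=
  dif_pos h

theorem continuousAt_ofVec {u : Fin (n + 1) → ℂ} (h : u ≠ 0) : ContinuousAt ofVec u := by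
  have : ContinuousOn (ofVec (n := n)) {u | u ≠ 0} := by
    rw [continuousOn_iff_continuous_domRestrict]
    convert isOpenQuotientMap_mk.continuous using 1
    ext u
    exact ofVec_of_ne_zero u.2
  exact this.continuousAt (isOpen_ne.mem_nhds h)

theorem ofVec_smul {c : ℂ} (hc : c ≠ 0) (u : Fin (n + 1) → ℂ) : ofVec (c • u) = ofVec u := by
  by_cases h : u = 0
  · simp [h]
  · rw [ofVec_of_ne_zero h, ofVec_of_ne_zero (smul_ne_zero hc h)]
    exact Quotient.sound ⟨Units.mk0 c hc, rfl⟩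

/-- A choice of homogeneous coordinates. -/
def rep (c : CP n) : Fin (n + 1) → ℂ := Projectivization.rep c

theorem rep_ne_zero (c : CP n) : c.rep ≠ 0 := Projectivization.rep_nonzero c

@[simp]
theorem ofVec_rep (c : CP n) : ofVec c.rep = c := by
  rw [ofVec_of_ne_zero c.rep_ne_zero]
  exact Projectivization.mk_rep c

theorem exists_rep_mk (u : {u : Fin (n + 1) → ℂ // u ≠ 0}) :
    ∃ c : ℂ, c ≠ 0 ∧ (mk u).rep = c • u.1 := by
  obtain ⟨c, hc⟩ := Projectivization.exists_smul_eq_mk_rep ℂ u.1 u.2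
  exact ⟨c, c.ne_zero, hc.symm⟩

theorem exists_rep_ofVec {u : Fin (n + 1) → ℂ} (h : u ≠ 0) :
    ∃ c : ℂ, c ≠ 0 ∧ (ofVec u).rep = c • u := by
  rw [ofVec_of_ne_zero h]
  exact exists_rep_mk ⟨u, h⟩

variable {A : Type*}

/-- The map on projective spaces given by a homogeneous map `h a` on coordinates. -/
def descend (h : A → (Fin (n + 1) → ℂ) → Fin (m + 1) → ℂ) (a : A) (c : CP n) : CP m :=
  ofVec (h a c.rep)

section descend

variable {h : A → (Fin (n + 1) → ℂ) → Fin (m + 1) → ℂ}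
  (hom : ∀ a (c : ℂ) u, h a (c • u) = c • h a u)

include hom

theorem descend_ofVec (a : A) {u : Fin (n + 1) → ℂ} (hu : u ≠ 0) :
    descend h a (ofVec u) = ofVec (h a u) := by
  obtain ⟨c, hc, e⟩ := exists_rep_ofVec hu
  rw [descend, e, hom, ofVec_smul hc]

theorem continuousAt_descend [TopologicalSpace A] (hc : Continuous (Function.uncurry h))
    (a : A) (c : CP n) (h0 : h a c.rep ≠ 0) :
    ContinuousAt (Function.uncurry (descend h)) (a, c) := by
  have hq := (IsOpenQuotientMap.id (X := A)).prodMap (isOpenQuotientMap_mk (n := n))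
  have e : (a, c) =
      Prod.map id mk (a, (⟨c.rep, c.rep_ne_zero⟩ : {u : Fin (n + 1) → ℂ // u ≠ 0})) := by
    simp only [Prod.map_apply, id, ← ofVec_of_ne_zero, ofVec_rep]
  rw [e, ← hq.continuousAt_comp_iff]
  have e' : Function.uncurry (descend h) ∘ Prod.map id mk =
      fun p : A × {u : Fin (n + 1) → ℂ // u ≠ 0} => ofVec (h p.1 p.2.1) := by
    ext p
    simp only [Function.comp, Prod.map, Function.uncurry, id]
    rw [← ofVec_of_ne_zero p.2.2, descend_ofVec hom _ p.2.2]
  rw [e']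
  refine ContinuousAt.comp (g := ofVec) (continuousAt_ofVec h0) (Continuous.continuousAt ?_)
  exact hc.comp (continuous_id.prodMap continuous_subtype_val)

theorem continuous_descend [TopologicalSpace A] (hc : Continuous (Function.uncurry h))
    {Z : Type*} [TopologicalSpace Z] {α : Z → A} {f : Z → CP n}
    (hα : Continuous α) (hf : Continuous f) (h0 : ∀ z, h (α z) (f z).rep ≠ 0) :
    Continuous fun z => descend h (α z) (f z) :=
  continuous_iff_continuousAt.mpr fun z =>
    (continuousAt_descend hom hc _ _ (h0 z)).comp (f := fun z => (α z, f z))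
      (hα.prodMk hf).continuousAt

end descend

/-- Linear automorphisms act transitively on projective space. -/
theorem exists_homeomorph_apply_eq (x y : CP n) : ∃ e : CP n ≃ₜ CP n, e x = y := by
  obtain ⟨L, hL⟩ := SeparatingDual.exists_continuousLinearEquiv_apply_eq (R := ℂ)
    x.rep_ne_zero y.rep_ne_zero
  have cont (L : (Fin (n + 1) → ℂ) ≃L[ℂ] (Fin (n + 1) → ℂ)) :
      Continuous (descend (fun _ : Unit => L) ()) := by
    refine continuous_descend (fun _ c u => map_smul L c u) ?_ continuous_const continuous_id
      fun z => ?_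
    · exact L.continuous.comp continuous_snd
    · simpa using rep_ne_zero z
  have inv (L L' : (Fin (n + 1) → ℂ) ≃L[ℂ] (Fin (n + 1) → ℂ)) (h : ∀ u, L' (L u) = u) (c : CP n) :
      descend (fun _ : Unit => L') () (descend (fun _ : Unit => L) () c) = c := by
    rw [descend.eq_def (fun _ : Unit => L), descend_ofVec (fun _ c u => map_smul L' c u), h,
      ofVec_rep]
    simpa using rep_ne_zero c
  refine ⟨⟨⟨_, _, inv L L.symm L.symm_apply_apply, inv L.symm L L.apply_symm_apply⟩,
    cont L, cont L.symm⟩, ?_⟩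
  change ofVec (L x.rep) = y
  rw [hL, ofVec_rep]

theorem cons_zero_smul (c : ℂ) (u : Fin (n + 1) → ℂ) :
    (Fin.cons 0 (c • u) : Fin (n + 2) → ℂ) = c • (Fin.cons 0 u : Fin (n + 2) → ℂ) := by
  ext i
  refine Fin.cases ?_ (fun i => ?_) i <;> simp

/-- The inclusion `ℂℙⁿ ⊆ ℂℙⁿ⁺¹` as the hyperplane where the first coordinate vanishes. -/
def incl (n : ℕ) : C(CP n, CP (n + 1)) where
  toFun := descend (fun (_ : Unit) u => Fin.cons 0 u) ()
  continuous_toFun := by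
    refine continuous_descend (fun _ => cons_zero_smul) ?_ continuous_const continuous_id
      fun z => ?_
    · refine continuous_pi (Fin.cases ?_ fun i => ?_) <;>
        simp only [Function.uncurry, Fin.cons_zero, Fin.cons_succ] <;> fun_prop
    · intro h
      exact z.rep_ne_zero (funext fun i => by simpa using congrFun h i.succ)

/-- The projection of `ℂℙⁿ⁺¹` onto the hyperplane `ℂℙⁿ` from the point with affine coordinate
`-v`. -/
def retract (v : Fin (n + 1) → ℂ) (c : CP (n + 1)) : CP n :=
  descend (fun v u => Fin.tail u + u 0 • v) v c

/-- The homotopy from the identity of `ℂℙⁿ⁺¹` to the projection from a point. -/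
def slide (p : ℝ × (Fin (n + 1) → ℂ)) (c : CP (n + 1)) : CP (n + 1) :=
  descend (fun p u => Fin.cons (((1 - p.1 : ℝ) : ℂ) * u 0) (Fin.tail u + ((p.1 : ℂ) * u 0) • p.2))
    p c

variable {Z : Type*} [TopologicalSpace Z]

theorem continuous_retract {v : Z → Fin (n + 1) → ℂ} {f : Z → CP (n + 1)}
    (hv : Continuous v) (hf : Continuous f)
    (h : ∀ z, Fin.tail (f z).rep + (f z).rep 0 • v z ≠ 0) :
    Continuous fun z => retract (v z) (f z) := by
  refine continuous_descend ?_ ?_ hv hf h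
  · intro a c u
    ext i
    simp [Fin.tail, mul_add, mul_assoc]
  · unfold Function.uncurry Fin.tail
    fun_prop

theorem slide_hom (p : ℝ × (Fin (n + 1) → ℂ)) (c : ℂ) (u : Fin (n + 2) → ℂ) :
    (Fin.cons (((1 - p.1 : ℝ) : ℂ) * (c • u) 0)
      (Fin.tail (c • u) + ((p.1 : ℂ) * (c • u) 0) • p.2) : Fin (n + 2) → ℂ) =
    c • (Fin.cons (((1 - p.1 : ℝ) : ℂ) * u 0) (Fin.tail u + ((p.1 : ℂ) * u 0) • p.2) :
      Fin (n + 2) → ℂ) := by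
  ext i
  refine Fin.cases ?_ (fun i => ?_) i
  · simp; ring
  · simp [Fin.tail]; ring

theorem continuous_slide {v : Z → ℝ × (Fin (n + 1) → ℂ)} {f : Z → CP (n + 1)}
    (hv : Continuous v) (hf : Continuous f)
    (h : ∀ z, Fin.tail (f z).rep + (f z).rep 0 • (v z).2 ≠ 0) :
    Continuous fun z => slide (v z) (f z) := by
  refine continuous_descend slide_hom ?_ hv hf fun z h' => ?_
  · refine continuous_pi (Fin.cases ?_ fun i => ?_)
    · simp only [Function.uncurry, Fin.cons_zero]
      fun_prop
    · simp only [Function.uncurry, Fin.cons_succ, Fin.tail, Pi.add_apply, Pi.smul_apply]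
      fun_prop
  · have h0 : ((1 - (v z).1 : ℝ) : ℂ) * (f z).rep 0 = 0 := by simpa using congrFun h' 0
    have h1 : Fin.tail (f z).rep + (((v z).1 : ℂ) * (f z).rep 0) • (v z).2 = 0 :=
      funext fun i => by simpa using congrFun h' i.succ
    apply h z
    rw [← h1]
    congr 2
    push_cast at h0
    linear_combination h0

theorem slide_zero (v : Fin (n + 1) → ℂ) (c : CP (n + 1)) : slide (0, v) c = c := by
  simp [slide, descend]

theorem slide_one (v : Fin (n + 1) → ℂ) (c : CP (n + 1))
    (h : Fin.tail c.rep + c.rep 0 • v ≠ 0) : slide (1, v) c = incl n (retract v c) := by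
  change _ = descend (fun (_ : Unit) u => Fin.cons 0 u) () (ofVec _)
  rw [descend_ofVec (fun _ => cons_zero_smul) _ h]
  simp [slide, descend]

theorem exists_rep_incl (x : CP n) :
    ∃ c : ℂ, c ≠ 0 ∧ (incl n x).rep = Fin.cons 0 (c • x.rep) := by
  have h : (Fin.cons 0 x.rep : Fin (n + 2) → ℂ) ≠ 0 := fun h =>
    x.rep_ne_zero (funext fun i => by simpa using congrFun h i.succ)
  obtain ⟨c, hc, e⟩ := exists_rep_ofVec h
  refine ⟨c, hc, e.trans (funext (Fin.cases ?_ fun i => ?_))⟩ <;> simp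

theorem retract_incl (v : Fin (n + 1) → ℂ) (x : CP n) : retract v (incl n x) = x := by
  obtain ⟨c, hc, e⟩ := exists_rep_incl x
  simp [retract, descend, e, ofVec_smul hc]

theorem slide_incl (p : ℝ × (Fin (n + 1) → ℂ)) (x : CP n) : slide p (incl n x) = incl n x := by
  obtain ⟨c, hc, e⟩ := exists_rep_incl x
  conv_rhs => rw [← ofVec_rep (incl n x), e]
  simp [slide, descend, e]

/-- The affine coordinate `z / w` of a point `[w : z]`, scaled down where `‖w‖ < ‖z‖`. -/
def affine (c : CP (n + 1)) : Fin (n + 1) → ℂ :=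
  (star (c.rep 0) / (‖c.rep‖ : ℂ) ^ 2) • Fin.tail c.rep

theorem continuous_affine : Continuous (affine (n := n)) := by
  rw [← isOpenQuotientMap_mk.continuous_comp_iff]
  have : affine ∘ mk = fun u : {u : Fin (n + 2) → ℂ // u ≠ 0} =>
      (star (u.1 0) / (‖u.1‖ : ℂ) ^ 2) • Fin.tail u.1 := by
    ext u i
    obtain ⟨c, hc, e⟩ := exists_rep_mk u
    have hu : (‖u.1‖ : ℂ) ≠ 0 := by simpa using u.2
    have hc' : (‖c‖ : ℂ) ≠ 0 := by simpa using hc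
    have hcc : star c * c = (‖c‖ : ℂ) ^ 2 := by
      simpa using RCLike.conj_mul c
    simp only [affine, Function.comp, e, Pi.smul_apply, smul_eq_mul, norm_smul, Fin.tail, star_mul',
      Complex.ofReal_mul]
    field_simp
    linear_combination (u.1 i.succ) * star (u.1 0) * hcc
  rw [this]
  have h0 : ∀ u : {u : Fin (n + 2) → ℂ // u ≠ 0}, (‖u.1‖ : ℂ) ^ 2 ≠ 0 := fun u => by
    simpa using u.2
  refine Continuous.smul (Continuous.div ?_ (by fun_prop) h0) ?_
  · exact ((continuous_apply 0).comp continuous_subtype_val).star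
  · exact continuous_pi fun i => (continuous_apply i.succ).comp continuous_subtype_val

/-- A vector `v` of norm less than `1` along which `c` is translated to the point `[1 : 0]` is
minus the affine coordinate of `c`. -/
theorem affine_add_eq_zero {c : CP (n + 1)} {v : Fin (n + 1) → ℂ} (hv : ‖v‖ < 1)
    (h : Fin.tail c.rep + c.rep 0 • v = 0) : affine c + v = 0 := by
  have ht : Fin.tail c.rep = -(c.rep 0 • v) := eq_neg_of_add_eq_zero_left h
  have h0 : c.rep 0 ≠ 0 := by
    intro h0
    refine c.rep_ne_zero (funext (Fin.cases h0 fun i => ?_))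
    have := congrFun ht i
    simpa [Fin.tail, h0] using this
  have hnorm : ‖c.rep‖ = ‖c.rep 0‖ := by
    refine le_antisymm ((pi_norm_le_iff_of_nonneg (norm_nonneg _)).mpr
      (Fin.cases le_rfl fun i => ?_)) (norm_le_pi_norm _ _)
    have : c.rep i.succ = -(c.rep 0 * v i) := congrFun ht i
    rw [this, norm_neg, norm_mul]
    exact mul_le_of_le_one_right (norm_nonneg _) ((norm_le_pi_norm v i).trans hv.le)
  have hcc : star (c.rep 0) * c.rep 0 = (‖c.rep 0‖ : ℂ) ^ 2 := by
    simpa using RCLike.conj_mul (c.rep 0)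
  have hz : (‖c.rep 0‖ : ℂ) ^ 2 ≠ 0 := by simpa using h0
  rw [affine, ht, hnorm, smul_neg, smul_smul, div_mul_eq_mul_div, hcc, div_self hz, one_smul,
    neg_add_cancel]

/-- General position: a map from a space of dimension less than `2 (n + 1)` into `ℂℙⁿ⁺¹` can be
translated continuously so as to miss the point `[1 : 0]`. -/
theorem exists_continuous_avoid {E : Type*} [NormedAddCommGroup E] [NormedSpace ℝ E]
    [FiniteDimensional ℝ E] (hE : Module.finrank ℝ E < 2 * (n + 1)) {f : E → CP (n + 1)}
    (hf : Continuous f) :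
    ∃ v : E → Fin (n + 1) → ℂ, Continuous v ∧
      ∀ z, Fin.tail (f z).rep + (f z).rep 0 • v z ≠ 0 := by
  obtain ⟨g, hg, hgf, -⟩ := (continuous_affine.comp hf).exists_contDiff_approx 1
    (ε := fun _ => 1 / 2) continuous_const (fun _ => by norm_num)
  have hdim : Module.finrank ℝ E < Module.finrank ℝ (Fin (n + 1) → ℂ) := by
    rw [Module.finrank_pi_fintype]
    simp only [Complex.finrank_real_complex, Finset.sum_const, Finset.card_univ, Fintype.card_fin,
      smul_eq_mul]
    lia
  obtain ⟨b, hb, hb0⟩ := (hg.dense_compl_range_of_finrank_lt_finrank hdim).exists_dist_lt 0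
    (ε := 1 / 2) (by norm_num)
  refine ⟨fun z => g z - b - affine (f z),
    (hg.continuous.sub continuous_const).sub (continuous_affine.comp hf), fun z hz => ?_⟩
  have hlt : ‖g z - b - affine (f z)‖ < 1 := by
    have h1 := hgf z
    rw [dist_eq_norm] at h1
    rw [dist_zero_left] at hb0
    calc ‖g z - b - affine (f z)‖ = ‖(g z - affine (f z)) - b‖ := by congr 1; abel
      _ ≤ ‖g z - affine (f z)‖ + ‖b‖ := norm_sub_le _ _
      _ < 1 / 2 + 1 / 2 := add_lt_add h1 hb0
      _ = 1 := by norm_num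
  have := affine_add_eq_zero hlt hz
  refine hb ⟨z, ?_⟩
  rw [← sub_eq_zero, ← this]
  abel

variable {N : Type*} [Fintype N] [DecidableEq N] [Nonempty N]

/-- The retraction of `ℝ` onto the unit interval. -/
def clamp (t : ℝ) : I := Set.projIcc 0 1 zero_le_one t

theorem continuous_clamp : Continuous clamp := continuous_projIcc (h := zero_le_one)

@[simp]
theorem clamp_coe (t : I) : clamp t = t := Set.projIcc_val _ t

theorem surjective_map_incl (hN : Fintype.card N < 2 * (n + 1)) (x : CP n) :
    Function.Surjective (HomotopyGroup.map (N := N) (incl n) (rfl : incl n x = _)) := by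
  rintro ⟨f⟩
  have hf : Continuous fun z : N → ℝ => f fun i => clamp (z i) :=
    f.1.continuous.comp (continuous_pi fun i => continuous_clamp.comp (continuous_apply i))
  obtain ⟨v, hv, h⟩ := exists_continuous_avoid (by simpa using hN) hf
  set w : (I^N) → Fin (n + 1) → ℂ := fun t => v fun i => t i
  have cw : Continuous w := hv.comp (by fun_prop)
  have hw' (t : I^N) : Fin.tail (f t).rep + (f t).rep 0 • w t ≠ 0 := by
    simpa using h fun i => t i
  let g : Ω^ N (CP n) x := ⟨⟨fun t => retract (w t) (f t),
    continuous_retract cw f.1.continuous hw'⟩, fun t ht => by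
      change retract (w t) (f t) = x
      exact (congrArg _ (f.2 t ht)).trans (retract_incl _ x)⟩
  refine ⟨Quotient.mk _ g, Eq.symm (Quotient.sound ⟨?_⟩)⟩
  exact
    { toFun p := slide (p.1, w p.2) (f p.2)
      continuous_toFun := continuous_slide
        ((continuous_subtype_val.comp continuous_fst).prodMk (cw.comp continuous_snd))
        (f.1.continuous.comp continuous_snd) fun p => hw' p.2
      map_zero_left t := slide_zero _ _
      map_one_left t := slide_one _ _ (hw' t)
      prop' s t ht := by
        change slide _ (f t) = f t
        exact (congrArg _ (f.2 t ht)).trans ((slide_incl _ x).trans (f.2 t ht).symm) }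

theorem injective_map_incl (hN : Fintype.card N + 1 < 2 * (n + 1)) (x : CP n) :
    Function.Injective (HomotopyGroup.map (N := N) (incl n) (rfl : incl n x = _)) := by
  rintro ⟨f⟩ ⟨g⟩ hfg
  obtain ⟨F⟩ := Quotient.exact hfg
  have hF : Continuous fun z : ℝ × (N → ℝ) => F (clamp z.1, fun i => clamp (z.2 i)) :=
    F.continuous.comp ((continuous_clamp.comp continuous_fst).prodMk
      (continuous_pi fun i => continuous_clamp.comp ((continuous_apply i).comp continuous_snd)))
  obtain ⟨v, hv, h⟩ := exists_continuous_avoid (by simpa [add_comm] using hN) hF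
  set w : I × (I^N) → Fin (n + 1) → ℂ := fun p => v (p.1, fun i => p.2 i)
  have cw : Continuous w := hv.comp (by fun_prop)
  have hw' (p : I × (I^N)) : Fin.tail (F p).rep + (F p).rep 0 • w p ≠ 0 := by
    simpa using h (p.1, fun i => p.2 i)
  refine Quotient.sound ⟨?_⟩
  exact
    { toFun p := retract (w p) (F p)
      continuous_toFun := continuous_retract cw F.continuous hw'
      map_zero_left t := by
        rw [F.apply_zero]
        exact retract_incl _ _
      map_one_left t := by
        rw [F.apply_one]
        exact retract_incl _ _
      prop' s t ht := by
        change retract _ (F (s, t)) = f t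
        rw [F.eq_fst s ht]
        exact retract_incl _ _ }

/-- `π_N(ℂℙⁿ) ≅ π_N(ℂℙⁿ⁺¹)` when `|N| ≤ 2n`, for all choices of base points. -/
theorem nonempty_homotopyGroup_mulEquiv_succ (hN : Fintype.card N ≤ 2 * n) (x : CP n)
    (y : CP (n + 1)) :
    Nonempty (HomotopyGroup N (CP n) x ≃* HomotopyGroup N (CP (n + 1)) y) := by
  obtain ⟨e, he⟩ := exists_homeomorph_apply_eq (incl n x) y
  exact ⟨(MulEquiv.ofBijective _ ⟨injective_map_incl (by lia) x,
    surjective_map_incl (by lia) x⟩).trans (HomotopyGroup.congrHomeomorph e he)⟩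

/-- `π_N(ℂℙⁿ) ≅ π_N(ℂℙⁿ⁺ᵏ)` when `|N| ≤ 2n`, for all choices of base points. -/
theorem nonempty_homotopyGroup_mulEquiv_add (hN : Fintype.card N ≤ 2 * n) (k : ℕ) (x : CP n)
    (y : CP (n + k)) :
    Nonempty (HomotopyGroup N (CP n) x ≃* HomotopyGroup N (CP (n + k)) y) := by
  induction k with
  | zero =>
    obtain ⟨e, he⟩ := exists_homeomorph_apply_eq x y
    exact ⟨HomotopyGroup.congrHomeomorph e he⟩
  | succ k ih =>
    obtain ⟨e₁⟩ := ih (ofVec fun _ => 1)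
    obtain ⟨e₂⟩ := nonempty_homotopyGroup_mulEquiv_succ (N := N) (n := n + k) (by lia)
      (ofVec fun _ => 1) y
    exact ⟨e₁.trans e₂⟩

end CP

theorem stmt14 (j δ : ℤ) (hj : 1 ≤ j) (hδ : δ = 0 ∨ δ = 1)
    (hn : 1 ≤ 4 * j - 5 + 2 * δ) (q : ℕ)
    (hq : (q : ℤ) + 1 ≤ 2 * (4 * j - 5 + 2 * δ))
    (x : CP (4 * j - 5 + 2 * δ).toNat) (y : CP ((4 * j - 5 + 2 * δ).toNat + 4)) :
    Nonempty
      (HomotopyGroup (Fin (q + 1)) (CP (4 * j - 5 + 2 * δ).toNat) x ≃*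
       HomotopyGroup (Fin (q + 1)) (CP ((4 * j - 5 + 2 * δ).toNat + 4)) y) := by
  exact CP.nonempty_homotopyGroup_mulEquiv_add (by rw [Fintype.card_fin]; lia) 4 x y
end
end
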